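/- Let d > 2, let λ be a compactly supported Borel probability measure on ℝ^d, let 0 < α < α' < 1, and suppose λ(B(x,δ)) ≤ C δ^{α'} for all x ∈ ℝ^d and δ > 0. Fix 0 < r_0 < R_0 < ∞ and t ∈ [0,1), and define exponents by (1/p, 1/q, 1/s) = t(1/(1+α), 1/(1+α), (1−α)/(1+α)) + (1−t)(1, 0, 1) (where 1/q = 0 means q = ∞ and the outer norm is the λ-essential supremum). Then there is a constant C' (depending on r_0, R_0, the diameter of the support of λ, C, and t) such that for every bounded Borel measurable function f on ℝ^d with compact support: (∫_{ℝ^d} (∫_{r_0}^{R_0} |Sf(x,r)|^s dr)^{q/s} dλ(x))^{1/q} ≤ C' ‖f‖_{L^p(ℝ^d)}. -/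

import Mathlib

open MeasureTheory Metric ENNReal

/-- The spherical average `Sf(x,r) = ∫_{S^{d-1}} f(x - rσ) dσ`, where the surface
measure on the unit sphere is realized as `(d-1)`-dimensional Hausdorff measure. -/
noncomputable def sphAvg {d : ℕ} (f : EuclideanSpace ℝ (Fin d) → ℝ)
    (x : EuclideanSpace ℝ (Fin d)) (r : ℝ) : ℝ :=
  ∫ σ in Metric.sphere (0 : EuclideanSpace ℝ (Fin d)) 1, f (x - r • σ) ∂(μH[(d : ℝ) - 1])

section

open Set Measure
open scoped Pointwise

section Polar

variable {E : Type*} [NormedAddCommGroup E] [NormedSpace ℝ E] [FiniteDimensional ℝ E]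
  [MeasurableSpace E] [BorelSpace E] [Nontrivial E]

theorem lintegral_eq_toSphere_lintegral (μ : Measure E) [μ.IsAddHaarMeasure]
    {f : E → ℝ≥0∞} (hf : Measurable f) :
    ∫⁻ y, f y ∂μ = ∫⁻ σ : sphere (0 : E) 1, (∫⁻ r in Ioi (0 : ℝ),
      ENNReal.ofReal (r ^ (Module.finrank ℝ E - 1)) * f (r • (σ : E))) ∂μ.toSphere := by
  have h1 : ∫⁻ y, f y ∂μ = ∫⁻ y : ({(0 : E)}ᶜ : Set E), f y ∂(μ.comap (↑)) := by
    rw [lintegral_subtype_comap (measurableSet_singleton _).compl, restrict_compl_singleton]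
  have h2 := μ.measurePreserving_homeomorphUnitSphereProd.symm
    (homeomorphUnitSphereProd E).toMeasurableEquiv
  rw [h1, ← h2.lintegral_comp (f := fun y : ({(0 : E)}ᶜ : Set E) => f y)
    (hf.comp measurable_subtype_coe), lintegral_prod]
  · refine lintegral_congr fun σ => ?_
    rw [volumeIoiPow, lintegral_withDensity_eq_lintegral_mul _ (by fun_prop)]
    · rw [← lintegral_subtype_comap measurableSet_Ioi]
      rfl
    · refine hf.comp (measurable_subtype_coe.comp (h2.measurable.comp ?_))
      fun_prop
  · exact ((hf.comp measurable_subtype_coe).comp h2.measurable).aemeasurable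

theorem lintegral_fun_norm_addHaar (μ : Measure E) [μ.IsAddHaarMeasure]
    {f : ℝ → ℝ≥0∞} (hf : Measurable f) :
    ∫⁻ y, f ‖y‖ ∂μ = μ.toSphere univ * ∫⁻ r in Ioi (0 : ℝ),
      ENNReal.ofReal (r ^ (Module.finrank ℝ E - 1)) * f r := by
  rw [lintegral_eq_toSphere_lintegral μ (f := fun y => f ‖y‖) (hf.comp measurable_norm)]
  rw [mul_comm, ← lintegral_const]
  refine lintegral_congr fun σ => setLIntegral_congr_fun measurableSet_Ioi fun r hr => ?_
  have : ‖(σ : E)‖ = 1 := by simp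
  simp [norm_smul, abs_of_pos (show (0 : ℝ) < r from hr)]

end Polar

section Hausdorff

theorem hausdorffMeasure_le_two_mul_cone {E : Type*} [NormedAddCommGroup E] [NormedSpace ℝ E]
    [MeasurableSpace E] [BorelSpace E] {A : Set E} (hA : A ⊆ sphere (0 : E) 1) {s : ℝ}
    (hs : 1 ≤ s) :
    μH[s - 1] A ≤ 2 * μH[s] (Icc (1 : ℝ) 2 • A) := by
  rw [hausdorffMeasure_apply, hausdorffMeasure_apply, ENNReal.mul_iSup]
  refine iSup_mono fun δ => ?_
  rw [ENNReal.mul_iSup]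
  refine iSup_mono fun hδ => ?_
  simp only [ENNReal.mul_iInf_of_ne two_ne_zero ofNat_ne_top]
  refine le_iInf fun t => le_iInf fun ht => le_iInf fun hdiam => ?_
  set X := ⨅ (t : ℕ → Set E) (_ : A ⊆ ⋃ n, t n) (_ : ∀ n, ediam (t n) ≤ δ),
          ∑' n, ⨆ _ : (t n).Nonempty, ediam (t n) ^ (s - 1) with hX
  have hI : ∀ n, ∃ I : Set ℝ, MeasurableSet I ∧
      volume I ≤ (⨆ _ : (t n).Nonempty, 2 * ediam (t n)) ∧ ∀ u ∈ t n, ‖u‖ ∈ I := by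
    intro n
    rcases (t n).eq_empty_or_nonempty with h | ⟨u, hu⟩
    · exact ⟨∅, MeasurableSet.empty, by simp, by simp [h]⟩
    · refine ⟨closedEBall ‖u‖ (ediam (t n)), isClosed_closedEBall.measurableSet, ?_, ?_⟩
      · rw [Real.volume_closedEBall, ciSup_pos ⟨u, hu⟩]
      · intro v hv
        rw [mem_closedEBall]
        refine le_trans ?_ (edist_le_ediam_of_mem hv hu)
        rw [edist_dist, edist_dist]
        exact ENNReal.ofReal_le_ofReal ((dist_norm_norm_le v u).trans_eq (dist_eq_norm v u).symm)
  choose I hIm hIv hIt using hI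
  have key : ∀ ρ ∈ Icc (1 : ℝ) 2,
      X ≤ ∑' n, (I n).indicator (fun _ => ediam (t n) ^ (s - 1)) ρ := by
    intro ρ hρ
    have hρ0 : 0 < ρ := by linarith [hρ.1]
    have hsub : ∀ n, ediam (A ∩ (fun a => ρ • a) ⁻¹' t n) ≤ ediam (t n) := by
      intro n
      refine ediam_le fun a ha b hb => le_trans ?_ (edist_le_ediam_of_mem ha.2 hb.2)
      rw [edist_dist, edist_dist]
      refine ENNReal.ofReal_le_ofReal ?_
      rw [dist_smul₀, Real.norm_of_nonneg hρ0.le]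
      nlinarith [hρ.1, dist_nonneg (x := a) (y := b)]
    have hcov : A ⊆ ⋃ n, A ∩ (fun a => ρ • a) ⁻¹' t n := by
      intro a ha
      have := ht (smul_mem_smul hρ ha)
      rw [mem_iUnion] at this ⊢
      exact this.imp fun n hn => ⟨ha, hn⟩
    refine (iInf₂_le_of_le (fun n => A ∩ (fun a => ρ • a) ⁻¹' t n) hcov
      (iInf_le _ (fun n => (hsub n).trans (hdiam n)))).trans ?_
    · refine ENNReal.tsum_le_tsum fun n => iSup_le fun ⟨a, ha, hat⟩ => ?_
      have : ρ ∈ I n := by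
        have := hIt n _ hat
        rwa [norm_smul, mem_sphere_zero_iff_norm.1 (hA ha), mul_one,
          Real.norm_of_nonneg hρ0.le] at this
      rw [indicator_of_mem this]
      exact ENNReal.rpow_le_rpow (hsub n) (by linarith)
  calc X = ∫⁻ ρ in Icc (1 : ℝ) 2, X := by
        rw [setLIntegral_const, Real.volume_Icc]; norm_num
    _ ≤ ∫⁻ ρ in Icc (1 : ℝ) 2, ∑' n, (I n).indicator (fun _ => ediam (t n) ^ (s - 1)) ρ :=
        setLIntegral_mono' measurableSet_Icc key
    _ ≤ ∫⁻ ρ, ∑' n, (I n).indicator (fun _ => ediam (t n) ^ (s - 1)) ρ :=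
        setLIntegral_le_lintegral _ _
    _ = ∑' n, ediam (t n) ^ (s - 1) * volume (I n) := by
        rw [lintegral_tsum fun n => (measurable_const.indicator (hIm n)).aemeasurable]
        refine tsum_congr fun n => ?_
        rw [lintegral_indicator_const (hIm n)]
    _ ≤ 2 * ∑' n, ⨆ _ : (t n).Nonempty, ediam (t n) ^ s := by
        rw [← ENNReal.tsum_mul_left]
        refine ENNReal.tsum_le_tsum fun n => ?_
        refine (mul_le_mul_right (hIv n) _).trans ?_
        by_cases h : (t n).Nonempty
        · rw [ciSup_pos h, ciSup_pos h]
          have : ediam (t n) ^ s = ediam (t n) ^ (s - 1) * ediam (t n) := by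
            conv_rhs => rw [← ENNReal.rpow_one (ediam (t n)), ← ENNReal.rpow_mul,
              ← ENNReal.rpow_add_of_nonneg _ _ (by linarith) zero_le_one]
            congr 1; ring
          rw [this]
          exact le_of_eq (by ring)
        · simp [h]

theorem exists_hausdorffMeasure_restrict_sphere_le {d : ℕ} (hd : 0 < d) :
    ∃ C : ℝ≥0∞, C ≠ ∞ ∧
      (μH[(d : ℝ) - 1] : Measure (EuclideanSpace ℝ (Fin d))).restrict (sphere 0 1) ≤
        C • (volume : Measure (EuclideanSpace ℝ (Fin d))).toSphere.map (↑) := by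
  have hdim : Module.finrank ℝ (EuclideanSpace ℝ (Fin d)) = d := by simp
  have hH := isAddLeftInvariant_eq_smul (μH[(d : ℝ)] : Measure (EuclideanSpace ℝ (Fin d))) volume
  set c := addHaarScalarFactor (μH[(d : ℝ)] : Measure (EuclideanSpace ℝ (Fin d))) volume
  refine ⟨2 * c * ENNReal.ofReal (3 ^ d), by finiteness, ?_⟩
  refine Measure.le_iff.2 fun A hA => ?_
  rw [restrict_apply hA, Measure.smul_apply, map_apply measurable_subtype_coe hA,
    toSphere_apply' _ (measurable_subtype_coe hA), Subtype.image_preimage_coe, hdim, inter_comm]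
  refine (hausdorffMeasure_le_two_mul_cone inter_subset_left
    (by exact_mod_cast hd)).trans ?_
  rw [hH, Measure.smul_apply]
  have hsub : Icc (1 : ℝ) 2 • (sphere (0 : EuclideanSpace ℝ (Fin d)) 1 ∩ A) ⊆
      (3 : ℝ) • (Ioo (0 : ℝ) 1 • (sphere (0 : EuclideanSpace ℝ (Fin d)) 1 ∩ A)) := by
    rintro _ ⟨r, hr, a, ha, rfl⟩
    refine ⟨(r / 3) • a, smul_mem_smul ⟨by linarith [hr.1], by linarith [hr.2]⟩ ha, ?_⟩
    simp only [smul_smul]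
    congr 1; ring
  have h1 : (1 : ℝ≥0∞) ≤ d := by exact_mod_cast hd
  have hvol := (measure_mono hsub).trans_eq (addHaar_smul volume (3 : ℝ) _)
  rw [hdim, abs_of_pos (by positivity)] at hvol
  rw [ENNReal.smul_def, smul_eq_mul, smul_eq_mul, mul_assoc, mul_assoc]
  gcongr
  refine hvol.trans ?_
  gcongr
  exact le_mul_of_one_le_left' h1

end Hausdorff

section SphericalMeans

theorem isFiniteMeasure_hausdorffMeasure_restrict_sphere {d : ℕ} (hd : 0 < d) :
    IsFiniteMeasure
      ((μH[(d : ℝ) - 1] : Measure (EuclideanSpace ℝ (Fin d))).restrict (sphere 0 1)) := by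
  obtain ⟨C, hC, hle⟩ := exists_hausdorffMeasure_restrict_sphere_le hd
  refine ⟨(hle univ).trans_lt ?_⟩
  rw [Measure.smul_apply, smul_eq_mul, map_apply measurable_subtype_coe MeasurableSet.univ]
  exact ENNReal.mul_lt_top hC.lt_top (measure_lt_top _ _)

theorem exists_lintegral_mul_sphere_le {d : ℕ} (hd : 0 < d) {r₀ : ℝ} (hr₀ : 0 < r₀) (R₀ : ℝ) :
    ∃ C : ℝ≥0∞, C ≠ ∞ ∧ ∀ (f : EuclideanSpace ℝ (Fin d) → ℝ≥0∞) (φ : ℝ → ℝ≥0∞),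
      Measurable f → Measurable φ → ∀ x : EuclideanSpace ℝ (Fin d),
      ∫⁻ r in Ioc r₀ R₀, φ r * ∫⁻ σ in sphere 0 1, f (x - r • σ) ∂μH[(d : ℝ) - 1] ≤
        C * ∫⁻ y, f y * φ ‖x - y‖ := by
  obtain ⟨C, hC, hle⟩ := exists_hausdorffMeasure_restrict_sphere_le hd
  have hne : Nonempty (Fin d) := ⟨⟨0, hd⟩⟩
  have hdim : Module.finrank ℝ (EuclideanSpace ℝ (Fin d)) = d := by simp
  set D := (ENNReal.ofReal (r₀ ^ (d - 1)))⁻¹ with hD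
  have hpos : ENNReal.ofReal (r₀ ^ (d - 1)) ≠ 0 := by
    rw [Ne, ENNReal.ofReal_eq_zero, not_le]; positivity
  have hDtop : D ≠ ∞ := ENNReal.inv_ne_top.2 hpos
  refine ⟨C * D, ENNReal.mul_ne_top hC hDtop, fun f φ hf hφ x => ?_⟩
  let τ := (volume : Measure (EuclideanSpace ℝ (Fin d))).toSphere
  have hsphere : ∀ r : ℝ, ∫⁻ σ in sphere 0 1, f (x - r • σ) ∂μH[(d : ℝ) - 1] ≤
      C * ∫⁻ σ : sphere (0 : EuclideanSpace ℝ (Fin d)) 1, f (x - r • (σ : _)) ∂τ := by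
    intro r
    refine (lintegral_mono' hle le_rfl).trans_eq ?_
    rw [lintegral_smul_measure, lintegral_map (by fun_prop) measurable_subtype_coe, smul_eq_mul]
  calc ∫⁻ r in Ioc r₀ R₀, φ r * ∫⁻ σ in sphere 0 1, f (x - r • σ) ∂μH[(d : ℝ) - 1]
      ≤ ∫⁻ r in Ioi 0, C * ∫⁻ σ : sphere (0 : EuclideanSpace ℝ (Fin d)) 1,
          D * (ENNReal.ofReal (r ^ (d - 1)) * (φ r * f (x - r • (σ : _)))) ∂τ := by
        refine (setLIntegral_mono' measurableSet_Ioc fun r hr => ?_).trans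
          (lintegral_mono_set fun r hr => hr₀.trans hr.1)
        refine (mul_le_mul_right (hsphere r) _).trans ?_
        rw [mul_left_comm, ← lintegral_const_mul _ (by fun_prop)]
        refine mul_le_mul_right (lintegral_mono fun σ => ?_) C
        rw [← mul_assoc D]
        refine le_mul_of_one_le_left' ?_
        rw [hD, mul_comm, ← ENNReal.div_eq_inv_mul.trans (mul_comm _ _),
          ENNReal.le_div_iff_mul_le (Or.inl hpos) (Or.inl ofReal_ne_top), one_mul]
        exact ENNReal.ofReal_le_ofReal (by gcongr; exact hr.1.le)
    _ = C * D * ∫⁻ σ : sphere (0 : EuclideanSpace ℝ (Fin d)) 1, (∫⁻ r in Ioi (0 : ℝ),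
          ENNReal.ofReal (r ^ (d - 1)) * (φ r * f (x - r • (σ : _)))) ∂τ := by
        rw [lintegral_const_mul' _ _ hC, lintegral_lintegral_swap (by fun_prop), mul_assoc,
          ← lintegral_const_mul' _ _ hDtop]
        congr 1
        exact lintegral_congr fun σ => lintegral_const_mul' _ _ hDtop
    _ = C * D * ∫⁻ y, φ ‖y‖ * f (x - y) := by
        rw [lintegral_eq_toSphere_lintegral volume (f := fun y => φ ‖y‖ * f (x - y)) (by fun_prop),
          hdim]
        congr 1
        refine lintegral_congr fun σ => setLIntegral_congr_fun measurableSet_Ioi fun r hr => ?_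
        have : ‖(σ : EuclideanSpace ℝ (Fin d))‖ = 1 := by simp
        simp [norm_smul, abs_of_pos (show (0 : ℝ) < r from hr)]
    _ = C * D * ∫⁻ y, f y * φ ‖x - y‖ := by
        rw [← lintegral_sub_left_eq_self (fun y => φ ‖y‖ * f (x - y)) x]
        simp [mul_comm]

end SphericalMeans

section Frostman

theorem exists_lintegral_edist_rpow_neg_le {X : Type*} [MetricSpace X] [MeasurableSpace X]
    [OpensMeasurableSpace X] (μ : Measure X) [IsFiniteMeasure μ] {α α' C : ℝ}
    (hα : 0 < α) (hαα' : α < α')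
    (hμ : ∀ (x : X) (δ : ℝ), 0 < δ → μ (ball x δ) ≤ ENNReal.ofReal (C * δ ^ α')) :
    ∃ K : ℝ≥0∞, K ≠ ∞ ∧ ∀ x, ∫⁻ y, edist x y ^ (-α) ∂μ ≤ K := by
  let w : ℕ → ℝ := fun j => ((1 / 2 : ℝ) ^ (j + 1)) ^ (-α)
  let δ : ℕ → ℝ := fun j => 2 * (1 / 2 : ℝ) ^ j
  have hwone : ∀ j, 1 ≤ w j := fun j =>
    Real.one_le_rpow_of_pos_of_le_one_of_nonpos (by positivity)
      (pow_le_one₀ (by norm_num) (by norm_num)) (by linarith)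
  have hpt : ∀ x y : X, edist x y ^ (-α) ≤
      1 + ∑' j, (ball x (δ j)).indicator (fun _ => ENNReal.ofReal (w j)) y := by
    intro x y
    rcases eq_or_ne x y with rfl | hxy
    · have : (∞ : ℝ≥0∞) ≤
          ∑' j, (ball x (δ j)).indicator (fun _ => ENNReal.ofReal (w j)) x := by
        rw [← ENNReal.tsum_const_eq_top_of_ne_zero (α := ℕ) one_ne_zero]
        refine ENNReal.tsum_le_tsum fun j => ?_
        rw [indicator_of_mem (mem_ball_self (by positivity))]
        simpa using ENNReal.ofReal_le_ofReal (hwone j)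
      exact le_top.trans (this.trans le_add_self)
    · have hd : 0 < dist x y := dist_pos.2 hxy
      rw [edist_dist, ENNReal.ofReal_rpow_of_pos hd]
      rcases le_or_gt 1 (dist x y) with h1 | h1
      · refine le_add_right ?_
        rw [ENNReal.ofReal_le_one]
        exact Real.rpow_le_one_of_one_le_of_nonpos h1 (by linarith)
      · obtain ⟨j, hj1, hj2⟩ := exists_nat_pow_near_of_lt_one hd h1.le
          (y := (1 / 2 : ℝ)) (by norm_num) (by norm_num)
        refine le_add_left ((?_ : _ ≤ _).trans (ENNReal.le_tsum j))
        rw [indicator_of_mem]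
        · exact ENNReal.ofReal_le_ofReal
            (Real.rpow_le_rpow_of_nonpos (by positivity) hj1.le (by linarith))
        · rw [mem_ball, dist_comm]
          have : (0 : ℝ) < (1 / 2) ^ j := by positivity
          simp only [δ]
          linarith
  refine ⟨μ univ + ∑' j, ENNReal.ofReal (w j) * ENNReal.ofReal (C * δ j ^ α'), ?_, fun x => ?_⟩
  · refine ENNReal.add_ne_top.2 ⟨measure_ne_top _ _, ?_⟩
    have hw : ∀ j, ENNReal.ofReal (w j) * ENNReal.ofReal (C * δ j ^ α') =
        ENNReal.ofReal (2 ^ α * C * 2 ^ α' * ((1 / 2 : ℝ) ^ (α' - α)) ^ j) := by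
      intro j
      rw [← ENNReal.ofReal_mul (by positivity)]
      congr 1
      simp only [w, δ]
      rw [Real.mul_rpow (by norm_num) (by positivity), ← Real.rpow_natCast, ← Real.rpow_natCast,
        ← Real.rpow_natCast, ← Real.rpow_mul (by norm_num), ← Real.rpow_mul (by norm_num),
        ← Real.rpow_mul (by norm_num)]
      have h2 : ∀ e : ℝ, (1 / 2 : ℝ) ^ e = 2 ^ (-e) := fun e => by
        rw [one_div, Real.inv_rpow (by norm_num), Real.rpow_neg (by norm_num)]
      simp only [h2]
      calc _ = C * ((2 : ℝ) ^ (-((j + 1 : ℕ) * -α)) * 2 ^ α' * 2 ^ (-(j * α'))) := by ring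
        _ = C * ((2 : ℝ) ^ α * 2 ^ α' * 2 ^ (-((α' - α) * j))) := by
            simp only [← Real.rpow_add (zero_lt_two' ℝ)]
            push_cast
            ring_nf
        _ = _ := by ring
    simp_rw [hw]
    refine Summable.tsum_ofReal_ne_top (Summable.mul_left _ ?_)
    exact summable_geometric_of_lt_one (by positivity)
      (Real.rpow_lt_one (by norm_num) (by norm_num) (by linarith))
  · refine (lintegral_mono (hpt x)).trans ?_
    rw [lintegral_add_left measurable_const, lintegral_const, one_mul,
      lintegral_tsum fun j => (measurable_const.indicator measurableSet_ball).aemeasurable]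
    gcongr with j
    rw [lintegral_indicator_const measurableSet_ball]
    gcongr
    exact hμ x _ (by positivity)

theorem measure_singleton_eq_zero_of_lintegral_edist_rpow_neg_ne_top {X : Type*} [MetricSpace X]
    [MeasurableSpace X] [OpensMeasurableSpace X] {μ : Measure X} {β : ℝ} (hβ : 0 < β) {x : X}
    (h : ∫⁻ y, edist x y ^ (-β) ∂μ ≠ ∞) : μ {x} = 0 := by
  have hae := ae_lt_top (by fun_prop) h
  refine measure_mono_null ?_ (ae_iff.1 hae)
  rintro y rfl
  simp [hβ]

end Frostman

section TestingInequality

theorem rpow_half_mul_le_half_add (a b : ℝ≥0∞) : (a * b) ^ (1 / 2 : ℝ) ≤ (a + b) / 2 := by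
  have h := ENNReal.young_inequality (a ^ (1 / 2 : ℝ)) (b ^ (1 / 2 : ℝ))
    Real.HolderConjugate.two_two
  rw [← ENNReal.mul_rpow_of_nonneg _ _ (by norm_num), ← ENNReal.rpow_mul, ← ENNReal.rpow_mul] at h
  simpa [ENNReal.add_div] using h

variable {X : Type*} [MetricSpace X] [SecondCountableTopology X] [MeasurableSpace X] [BorelSpace X]
  {μ : Measure X} [IsFiniteMeasure μ]

theorem ae_prod_edist_ne_zero [NullSingletonClass μ] : ∀ᵐ z ∂μ.prod μ, edist z.1 z.2 ≠ 0 := by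
  rw [Measure.ae_prod_iff_ae_ae]
  · refine Filter.Eventually.of_forall fun x => ?_
    filter_upwards [measure_eq_zero_iff_ae_notMem.1 (measure_singleton (μ := μ) x)] with y hy
    simpa [eq_comm] using hy
  · exact (measurableSet_eq_fun (by fun_prop) (by fun_prop)).compl

theorem lintegral_prod_edist_mul_rpow_half_le {β : ℝ} {K : ℝ≥0∞}
    (hK : ∀ x, ∫⁻ y, edist x y ^ (-β) ∂μ ≤ K) {w : X → ℝ≥0∞} (hw : Measurable w) :
    ∫⁻ z, (w z.1 * w z.2) ^ (1 / 2 : ℝ) * edist z.1 z.2 ^ (-β) ∂μ.prod μ ≤ K * ∫⁻ x, w x ∂μ := by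
  have h1 : ∫⁻ z, w z.1 * edist z.1 z.2 ^ (-β) ∂μ.prod μ ≤ K * ∫⁻ x, w x ∂μ := by
    rw [lintegral_prod _ (by fun_prop), ← lintegral_const_mul _ hw]
    refine lintegral_mono fun x => ?_
    exact (lintegral_const_mul _ (by fun_prop)).trans_le
      ((mul_comm _ _).trans_le (mul_le_mul_left (hK x) _))
  have h2 : ∫⁻ z, w z.2 * edist z.1 z.2 ^ (-β) ∂μ.prod μ =
      ∫⁻ z, w z.1 * edist z.1 z.2 ^ (-β) ∂μ.prod μ := by
    rw [← lintegral_prod_swap]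
    simp [edist_comm]
  calc _ ≤ ∫⁻ z, (w z.1 + w z.2) / 2 * edist z.1 z.2 ^ (-β) ∂μ.prod μ := by
        gcongr
        exact rpow_half_mul_le_half_add _ _
    _ = 2⁻¹ * (∫⁻ z, w z.1 * edist z.1 z.2 ^ (-β) ∂μ.prod μ +
          ∫⁻ z, w z.2 * edist z.1 z.2 ^ (-β) ∂μ.prod μ) := by
        rw [← lintegral_add_left (by fun_prop), ← lintegral_const_mul _ (by fun_prop)]
        refine lintegral_congr fun z => ?_
        rw [div_eq_mul_inv]
        ring
    _ = ∫⁻ z, w z.1 * edist z.1 z.2 ^ (-β) ∂μ.prod μ := by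
        rw [h2, ← two_mul, ← mul_assoc, ENNReal.inv_mul_cancel two_ne_zero ofNat_ne_top, one_mul]
    _ ≤ _ := h1

theorem lintegral_rpow_le_of_ne_top [NullSingletonClass μ] {β m P : ℝ} (hβ0 : 0 < β) (hβ1 : β < 1)
    (hm0 : 0 < m) (hm2 : m ≤ 2) (hP : P = 2 / m + 1 / β) {K : ℝ≥0∞}
    (hK : ∀ x, ∫⁻ y, edist x y ^ (-β) ∂μ ≤ K) {N u : X → ℝ≥0∞} (hN : Measurable N)
    (hu : Measurable u) (hNtop : ∀ x, N x ≠ ∞) (hutop : ∀ x, u x ≠ ∞)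
    (hNu : ∀ x, N x = 0 → u x = 0) (hH : ∫⁻ x, u x ∂μ ≠ ∞) :
    (∫⁻ x, u x ∂μ) ^ P ≤ (∫⁻ z, edist z.1 z.2 ^ (1 - β) * (N z.1 * N z.2) ^ (m / 2 - 1) *
      (u z.1 * u z.2) ^ (P / 2) ∂μ.prod μ) * K ^ (1 / β - 1) *
        (∫⁻ x, N x ^ m ∂μ) ^ (2 / m - 1) := by
  have hmi : 1 / 2 ≤ 1 / m := one_div_le_one_div_of_le hm0 hm2
  have hβi : 1 < 1 / β := by rwa [lt_div_iff₀ hβ0, one_mul]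
  have hP0 : 0 < P := by rw [hP]; positivity
  set D : ℝ := 1 / m + 1 / β - 1 / 2 with hD
  have hD0 : 0 < D := by linarith
  set H := ∫⁻ x, u x ∂μ with hHdef
  rcases eq_or_ne H 0 with h0 | h0
  · rw [h0, ENNReal.zero_rpow_of_pos hP0]
    exact zero_le
  set Q := ∫⁻ z, edist z.1 z.2 ^ (1 - β) * (N z.1 * N z.2) ^ (m / 2 - 1) *
      (u z.1 * u z.2) ^ (P / 2) ∂μ.prod μ with hQ
  set A := ∫⁻ x, N x ^ m ∂μ with hA
  let F : Fin 3 → X × X → ℝ≥0∞ := ![fun z => edist z.1 z.2 ^ (1 - β) *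
    (N z.1 * N z.2) ^ (m / 2 - 1) * (u z.1 * u z.2) ^ (P / 2),
    fun z => (u z.1 * u z.2) ^ (1 / 2 : ℝ) * edist z.1 z.2 ^ (-β),
    fun z => N z.1 ^ m * N z.2 ^ m]
  let a : Fin 3 → ℝ := ![1 / D, (1 / β - 1) / D, (1 / m - 1 / 2) / D]
  have hF : ∀ i ∈ Finset.univ, AEMeasurable (F i) (μ.prod μ) := by
    intro i _
    fin_cases i <;> simp [F] <;> fun_prop
  have ha0 : ∀ i ∈ Finset.univ, 0 ≤ a i := by
    intro i _
    have h1 : 0 ≤ (1 / β - 1) / D := div_nonneg (by linarith) hD0.le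
    have h2 : 0 ≤ (1 / m - 1 / 2) / D := div_nonneg (by linarith) hD0.le
    have h3 : 0 ≤ 1 / D := by positivity
    fin_cases i
    exacts [h3, h1, h2]
  have ha1 : ∑ i, a i = 1 := by
    simp only [a, Fin.sum_univ_three, Matrix.cons_val]
    rw [← add_div, ← add_div, div_eq_one_iff_eq hD0.ne', hD]
    ring
  have hhold := ENNReal.lintegral_prod_norm_pow_le Finset.univ hF ha1 ha0
  simp only [Fin.prod_univ_three, F, a, Matrix.cons_val] at hhold
  have hlow : ∫⁻ z, u z.1 * u z.2 ∂μ.prod μ = H ^ (2 : ℝ) := by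
    rw [lintegral_prod_mul hu.aemeasurable hu.aemeasurable, ← hHdef, ENNReal.rpow_two, sq]
  have hupp : ∫⁻ z, N z.1 ^ m * N z.2 ^ m ∂μ.prod μ = A ^ (2 : ℝ) := by
    rw [lintegral_prod_mul (f := fun x => N x ^ m) (g := fun x => N x ^ m) (by fun_prop) (by fun_prop),
      ← hA, ENNReal.rpow_two, sq]
  have hmain : H ^ (2 : ℝ) ≤
      Q ^ (1 / D) * (K * H) ^ ((1 / β - 1) / D) * (A ^ (2 : ℝ)) ^ ((1 / m - 1 / 2) / D) := by
    rw [← hlow, ← hupp]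
    refine le_trans ?_ (hhold.trans ?_)
    · refine lintegral_mono_ae ?_
      filter_upwards [ae_prod_edist_ne_zero (μ := μ)] with z hz
      rcases eq_or_ne (u z.1 * u z.2) 0 with hU | hU
      · rw [hU]
        exact zero_le
      have hW : N z.1 * N z.2 ≠ 0 :=
        mul_ne_zero (fun h => hU (by rw [hNu _ h, zero_mul])) fun h => hU (by rw [hNu _ h, mul_zero])
      have hWtop : N z.1 * N z.2 ≠ ∞ := ENNReal.mul_ne_top (hNtop _) (hNtop _)
      have hUtop : u z.1 * u z.2 ≠ ∞ := ENNReal.mul_ne_top (hutop _) (hutop _)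
      have hetop : edist z.1 z.2 ≠ ∞ := edist_ne_top _ _
      rw [← ENNReal.mul_rpow_of_nonneg _ _ hm0.le]
      generalize u z.1 * u z.2 = U at *
      generalize N z.1 * N z.2 = W at *
      generalize edist z.1 z.2 = e at *
      refine le_of_eq ?_
      rw [ENNReal.mul_rpow_of_nonneg _ _ (by positivity),
        ENNReal.mul_rpow_of_nonneg _ _ (by positivity),
        ENNReal.mul_rpow_of_nonneg _ _ (div_nonneg (by linarith) hD0.le)]
      simp only [← ENNReal.rpow_mul]
      have e1 : U ^ (P / 2 * (1 / D)) * U ^ (1 / 2 * ((1 / β - 1) / D)) = U := by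
        rw [← ENNReal.rpow_add _ _ hU hUtop]
        convert ENNReal.rpow_one U
        rw [hP]
        field_simp
        rw [hD]
        field_simp
        ring
      have e2 : W ^ ((m / 2 - 1) * (1 / D)) * W ^ (m * ((1 / m - 1 / 2) / D)) = 1 := by
        rw [← ENNReal.rpow_add _ _ hW hWtop]
        convert ENNReal.rpow_zero
        field_simp
        ring
      have e3 : e ^ ((1 - β) * (1 / D)) * e ^ (-β * ((1 / β - 1) / D)) = 1 := by
        rw [← ENNReal.rpow_add _ _ hz hetop]
        convert ENNReal.rpow_zero
        field_simp
        ring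
      calc U = (e ^ ((1 - β) * (1 / D)) * e ^ (-β * ((1 / β - 1) / D))) *
            (W ^ ((m / 2 - 1) * (1 / D)) * W ^ (m * ((1 / m - 1 / 2) / D))) *
            (U ^ (P / 2 * (1 / D)) * U ^ (1 / 2 * ((1 / β - 1) / D))) := by
              rw [e1, e2, e3, one_mul, one_mul]
        _ = _ := by ring
    · gcongr
      exact lintegral_prod_edist_mul_rpow_half_le hK hu
  have hpow := ENNReal.rpow_le_rpow hmain hD0.le
  rw [ENNReal.mul_rpow_of_nonneg _ _ hD0.le, ENNReal.mul_rpow_of_nonneg _ _ hD0.le] at hpow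
  simp only [← ENNReal.rpow_mul] at hpow
  rw [div_mul_cancel₀ _ hD0.ne', div_mul_cancel₀ _ hD0.ne', ENNReal.rpow_one,
    mul_assoc 2, div_mul_cancel₀ _ hD0.ne', ENNReal.mul_rpow_of_nonneg _ _ (by linarith),
    show 2 * (1 / m - 1 / 2) = 2 / m - 1 by ring,
    show 2 * D = P + (1 / β - 1) by rw [hP, hD]; ring, ENNReal.rpow_add _ _ h0 hH] at hpow
  have hHpos : H ^ (1 / β - 1) ≠ 0 := (ENNReal.rpow_pos (pos_iff_ne_zero.2 h0) hH).ne'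
  have hHtop : H ^ (1 / β - 1) ≠ ∞ := ENNReal.rpow_ne_top_of_nonneg (by linarith) hH
  rw [← ENNReal.mul_le_mul_iff_left hHpos hHtop]
  refine hpow.trans_eq ?_
  ring

theorem lintegral_rpow_le [NullSingletonClass μ] {β m P : ℝ} (hβ0 : 0 < β) (hβ1 : β < 1)
    (hm0 : 0 < m) (hm2 : m ≤ 2) (hP : P = 2 / m + 1 / β) {K : ℝ≥0∞}
    (hK : ∀ x, ∫⁻ y, edist x y ^ (-β) ∂μ ≤ K) {N u : X → ℝ≥0∞} (hN : Measurable N)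
    (hu : Measurable u) (hNtop : ∀ x, N x ≠ ∞) (hNu : ∀ x, N x = 0 → u x = 0) :
    (∫⁻ x, u x ∂μ) ^ P ≤ (∫⁻ z, edist z.1 z.2 ^ (1 - β) * (N z.1 * N z.2) ^ (m / 2 - 1) *
      (u z.1 * u z.2) ^ (P / 2) ∂μ.prod μ) * K ^ (1 / β - 1) *
        (∫⁻ x, N x ^ m ∂μ) ^ (2 / m - 1) := by
  have hP0 : 0 < P := by rw [hP]; positivity
  have hlim : ∫⁻ x, u x ∂μ = ⨆ n : ℕ, ∫⁻ x, min (u x) n ∂μ := by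
    rw [← lintegral_iSup (by fun_prop)]
    · refine lintegral_congr fun x => ?_
      rw [← inf_iSup_eq, ENNReal.iSup_natCast, inf_top_eq]
    · intro i j hij x
      dsimp only
      gcongr
  rw [← ENNReal.le_rpow_inv_iff hP0, hlim]
  refine iSup_le fun n => ?_
  rw [ENNReal.le_rpow_inv_iff hP0]
  refine (lintegral_rpow_le_of_ne_top hβ0 hβ1 hm0 hm2 hP hK hN (u := fun x => min (u x) n)
    (by fun_prop) hNtop (fun x => ((min_le_right _ _).trans_lt (natCast_lt_top n)).ne)
    (fun x hx => by simp [hNu x hx]) ?_).trans ?_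
  · refine ((lintegral_mono fun x => min_le_right (u x) (n : ℝ≥0∞)).trans_lt ?_).ne
    rw [lintegral_const]
    finiteness
  · gcongr <;> exact min_le_left _ _

end TestingInequality

section Bipolar

theorem two_mul_lintegral_Ioi_mul_comp_sq (Θ : ℝ → ℝ≥0∞) :
    2 * ∫⁻ h in Ioi (0 : ℝ), ENNReal.ofReal h * Θ (h ^ 2) = ∫⁻ u in Ioi (0 : ℝ), Θ u := by
  have himg : (fun h : ℝ => h ^ 2) '' Ioi 0 = Ioi 0 := by
    ext u
    constructor
    · rintro ⟨h, hh, rfl⟩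
      exact pow_pos (show (0 : ℝ) < h from hh) 2
    · intro hu
      exact ⟨√u, Real.sqrt_pos.2 hu, Real.sq_sqrt (le_of_lt hu)⟩
  have := lintegral_image_eq_lintegral_abs_deriv_mul (s := Ioi (0 : ℝ)) measurableSet_Ioi
    (f := fun h => h ^ 2) (f' := fun h => 2 * h)
    (fun h _ => by simpa using (hasDerivAt_pow 2 h).hasDerivWithinAt)
    (fun a ha b hb hab => by
      have ha' : (0 : ℝ) < a := ha
      have hb' : (0 : ℝ) < b := hb
      exact (pow_left_inj₀ ha'.le hb'.le two_ne_zero).1 hab) Θ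
  rw [himg] at this
  rw [this, ← lintegral_const_mul' _ _ ofNat_ne_top]
  refine setLIntegral_congr_fun measurableSet_Ioi fun h hh => ?_
  have hh' : (0 : ℝ) < h := hh
  rw [abs_of_pos (by positivity), ENNReal.ofReal_mul zero_le_two, mul_assoc]
  simp

theorem lintegral_comp_sqrt_le {R : ℝ} {ψ : ℝ → ℝ≥0∞} (hψ : ∀ r, r ∉ Ioc 0 R → ψ r = 0) :
    ∫⁻ v, ψ (√v) ≤ 2 * ENNReal.ofReal R * ∫⁻ r, ψ r := by
  have h1 : ∫⁻ v, ψ (√v) = ∫⁻ v in Ioi (0 : ℝ), ψ (√v) := by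
    rw [← lintegral_indicator measurableSet_Ioi]
    refine lintegral_congr fun v => ?_
    by_cases hv : v ∈ Ioi (0 : ℝ)
    · rw [indicator_of_mem hv]
    · rw [indicator_of_notMem hv, Real.sqrt_eq_zero_of_nonpos (by simpa using hv)]
      exact hψ _ (by simp)
  rw [h1, ← two_mul_lintegral_Ioi_mul_comp_sq, mul_assoc]
  gcongr
  rw [← lintegral_const_mul' _ _ ofReal_ne_top]
  refine (setLIntegral_mono' measurableSet_Ioi fun h hh => ?_).trans (setLIntegral_le_lintegral _ _)
  rw [Real.sqrt_sq (le_of_lt hh)]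
  by_cases hr : h ∈ Ioc 0 R
  · gcongr; exact hr.2
  · simp [hψ h hr]

theorem lintegral_half_plane_le {R ℓ : ℝ} (hℓ : 0 < ℓ) {φ ψ : ℝ → ℝ≥0∞}
    (hφm : Measurable φ) (hψm : Measurable ψ) (hφ : ∀ r, r ∉ Ioc 0 R → φ r = 0)
    (hψ : ∀ r, r ∉ Ioc 0 R → ψ r = 0) :
    ∫⁻ z : ℝ, ∫⁻ h in Ioi (0 : ℝ), ENNReal.ofReal h *
        (φ √(z ^ 2 + h ^ 2) * ψ √((z - ℓ) ^ 2 + h ^ 2)) ≤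
      4 * ENNReal.ofReal R ^ 2 * (ENNReal.ofReal ℓ)⁻¹ * (∫⁻ r, φ r) * ∫⁻ r, ψ r := by
  have inner : ∀ z : ℝ, ∫⁻ h in Ioi (0 : ℝ), ENNReal.ofReal h *
        (φ √(z ^ 2 + h ^ 2) * ψ √((z - ℓ) ^ 2 + h ^ 2)) ≤
      ∫⁻ u, φ √u * ψ √(u + ℓ ^ 2 - 2 * ℓ * z) := by
    intro z
    have h2 := two_mul_lintegral_Ioi_mul_comp_sq
      (fun u => φ √(z ^ 2 + u) * ψ √((z - ℓ) ^ 2 + u))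
    refine (le_mul_of_one_le_left' one_le_two).trans (h2.trans_le ?_)
    refine (setLIntegral_le_lintegral _ _).trans_eq ?_
    rw [← lintegral_add_left_eq_self (fun u => φ √u * ψ √(u + ℓ ^ 2 - 2 * ℓ * z)) (z ^ 2)]
    refine lintegral_congr fun u => ?_
    congr 3
    ring_nf
  have hlin : ∀ u : ℝ, ∫⁻ z, ψ √(u + ℓ ^ 2 - 2 * ℓ * z) ≤
      (ENNReal.ofReal ℓ)⁻¹ * ∫⁻ v, ψ √v := by
    intro u
    have h2ℓ : 2 * ℓ ≠ 0 := by positivity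
    have hmap := Real.map_volume_mul_left h2ℓ
    have : ∫⁻ z, ψ √(u + ℓ ^ 2 - 2 * ℓ * z) =
        ∫⁻ w, ψ √(u + ℓ ^ 2 - w) ∂(Measure.map (fun z => 2 * ℓ * z) volume) := by
      rw [lintegral_map (by fun_prop) (by fun_prop)]
    rw [this, hmap, lintegral_smul_measure, lintegral_sub_left_eq_self (fun v => ψ √v),
      smul_eq_mul, abs_of_pos (by positivity)]
    gcongr
    rw [← ENNReal.ofReal_inv_of_pos hℓ]
    refine ENNReal.ofReal_le_ofReal ?_
    gcongr
    linarith
  calc _ ≤ ∫⁻ z : ℝ, ∫⁻ u, φ √u * ψ √(u + ℓ ^ 2 - 2 * ℓ * z) := lintegral_mono inner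
    _ = ∫⁻ u, φ √u * ∫⁻ z, ψ √(u + ℓ ^ 2 - 2 * ℓ * z) := by
        rw [lintegral_lintegral_swap (by fun_prop)]
        refine lintegral_congr fun u => ?_
        rw [lintegral_const_mul _ (by fun_prop)]
    _ ≤ ∫⁻ u, φ √u * ((ENNReal.ofReal ℓ)⁻¹ * ∫⁻ v, ψ √v) := by
        gcongr with u; exact hlin u
    _ = (∫⁻ u, φ √u) * ((ENNReal.ofReal ℓ)⁻¹ * ∫⁻ v, ψ √v) := by
        rw [lintegral_mul_const _ (by fun_prop)]
    _ ≤ (2 * ENNReal.ofReal R * ∫⁻ r, φ r) *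
          ((ENNReal.ofReal ℓ)⁻¹ * (2 * ENNReal.ofReal R * ∫⁻ r, ψ r)) := by
        gcongr
        · exact lintegral_comp_sqrt_le hφ
        · exact lintegral_comp_sqrt_le hψ
    _ = _ := by ring

theorem lintegral_euclideanSpace_succ (n : ℕ) {F : ℝ → ℝ → ℝ≥0∞}
    (hF : Measurable (Function.uncurry F)) :
    ∫⁻ y : EuclideanSpace ℝ (Fin (n + 1)), F (y 0) (∑ i : Fin n, y i.succ ^ 2) =
      ∫⁻ z, ∫⁻ w : EuclideanSpace ℝ (Fin n), F z (‖w‖ ^ 2) := by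
  have hF' : ∀ {β : Type} [MeasurableSpace β] {g h : β → ℝ}, Measurable g → Measurable h →
      Measurable fun b => F (g b) (h b) := fun hg hh => hF.comp (hg.prodMk hh)
  have hm1 : Measurable fun y : Fin (n + 1) → ℝ => F (y 0) (∑ i : Fin n, y i.succ ^ 2) :=
    hF' (by fun_prop) (by fun_prop)
  have hm2 : Measurable fun p : ℝ × (Fin n → ℝ) => F p.1 (∑ i, p.2 i ^ 2) :=
    hF' (by fun_prop) (by fun_prop)
  have h1 := (PiLp.volume_preserving_ofLp (Fin (n + 1))).lintegral_comp hm1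
  have h2 := (volume_preserving_piFinSuccAbove (fun _ : Fin (n + 1) => ℝ) 0).lintegral_comp hm2
  rw [h1]
  refine (Eq.trans ?_ h2).trans ?_
  · rfl
  rw [volume_eq_prod, lintegral_prod _ hm2.aemeasurable]
  refine lintegral_congr fun z => ?_
  have h3 := (PiLp.volume_preserving_ofLp (Fin n)).lintegral_comp
    (f := fun w => F z (∑ i, w i ^ 2)) (hF' (by fun_prop) (by fun_prop))
  refine h3.symm.trans (lintegral_congr fun w => ?_)
  rw [EuclideanSpace.real_norm_sq_eq]

theorem exists_lintegral_bipolar_le {d : ℕ} (hd : 2 < d) (R : ℝ) :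
    ∃ K : ℝ≥0∞, K ≠ ∞ ∧ ∀ φ ψ : ℝ → ℝ≥0∞, Measurable φ → Measurable ψ →
      (∀ r, r ∉ Ioc 0 R → φ r = 0) → (∀ r, r ∉ Ioc 0 R → ψ r = 0) →
      ∀ x₁ x₂ : EuclideanSpace ℝ (Fin d), x₁ ≠ x₂ →
        ∫⁻ y, φ ‖x₁ - y‖ * ψ ‖x₂ - y‖ ≤
          K * (edist x₁ x₂)⁻¹ * (∫⁻ r, φ r) * ∫⁻ r, ψ r := by
  obtain ⟨n, rfl⟩ : ∃ n, d = n + 3 := ⟨d - 3, by omega⟩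
  set V := (volume : Measure (EuclideanSpace ℝ (Fin (n + 2)))).toSphere univ
  refine ⟨V * ENNReal.ofReal (R ^ n) * (4 * ENNReal.ofReal R ^ 2), ?_, ?_⟩
  · have : V ≠ ∞ := measure_ne_top _ _
    finiteness
  intro φ ψ hφm hψm hφ hψ x₁ x₂ hx
  set ℓ := ‖x₂ - x₁‖
  have hℓ : 0 < ℓ := norm_pos_iff.2 (sub_ne_zero.2 hx.symm)
  have hed : edist x₁ x₂ = ENNReal.ofReal ℓ := by
    rw [edist_comm, edist_dist, dist_eq_norm]
  obtain ⟨b, hb⟩ := Orthonormal.exists_orthonormalBasis_extension_of_card_eq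
    (E := EuclideanSpace ℝ (Fin (n + 3))) (𝕜 := ℝ) (ι := Fin (n + 3)) (by simp)
    (v := fun _ => ℓ⁻¹ • (x₂ - x₁)) (s := {0}) (by
      rw [orthonormal_iff_ite]
      rintro ⟨i, rfl⟩ ⟨j, rfl⟩
      have : ‖ℓ⁻¹ • (x₂ - x₁)‖ = 1 := by
        rw [norm_smul, norm_inv, norm_norm, inv_mul_cancel₀ hℓ.ne']
      simp [Set.domRestrict, this])
  have hv : b.repr (x₂ - x₁) = EuclideanSpace.single 0 ℓ := by
    have : x₂ - x₁ = ℓ • b 0 := by rw [hb 0 rfl, smul_inv_smul₀ hℓ.ne']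
    rw [this, map_smul, b.repr_self]
    ext i
    simp
  have hφ0 : ∀ z h : ℝ, 0 < h → ENNReal.ofReal (h ^ (n + 1)) * φ √(z ^ 2 + h ^ 2) ≤
      ENNReal.ofReal (R ^ n) * (ENNReal.ofReal h * φ √(z ^ 2 + h ^ 2)) := by
    intro z h hh
    by_cases hr : √(z ^ 2 + h ^ 2) ∈ Ioc 0 R
    · have : h ≤ R := (Real.le_sqrt_of_sq_le (by nlinarith)).trans hr.2
      rw [← mul_assoc, ← ENNReal.ofReal_mul' hh.le]
      gcongr
      rw [pow_succ]
      gcongr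
    · simp [hφ _ hr]
  calc ∫⁻ y, φ ‖x₁ - y‖ * ψ ‖x₂ - y‖
      = ∫⁻ y, φ ‖y‖ * ψ ‖x₂ - x₁ - y‖ := by
        rw [← lintegral_add_left_eq_self _ x₁]
        refine lintegral_congr fun y => ?_
        rw [sub_add_cancel_left, norm_neg, sub_add_eq_sub_sub]
    _ = ∫⁻ y : EuclideanSpace ℝ (Fin (n + 3)), φ ‖y‖ * ψ ‖EuclideanSpace.single 0 ℓ - y‖ := by
        rw [← b.measurePreserving_repr.lintegral_comp
          (f := fun y => φ ‖y‖ * ψ ‖EuclideanSpace.single 0 ℓ - y‖) (by fun_prop), ← hv]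
        refine lintegral_congr fun y => ?_
        rw [← map_sub, b.repr.norm_map, b.repr.norm_map]
    _ = ∫⁻ z, ∫⁻ w : EuclideanSpace ℝ (Fin (n + 2)),
          φ √(z ^ 2 + ‖w‖ ^ 2) * ψ √((z - ℓ) ^ 2 + ‖w‖ ^ 2) := by
        rw [← lintegral_euclideanSpace_succ (n + 2)
          (F := fun z u => φ √(z ^ 2 + u) * ψ √((z - ℓ) ^ 2 + u)) (by fun_prop)]
        refine lintegral_congr fun y => ?_
        simp [EuclideanSpace.norm_eq, Fin.sum_univ_succ (n := n + 2), sub_sq_comm ℓ]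
    _ ≤ ∫⁻ z, V * ∫⁻ h in Ioi (0 : ℝ), ENNReal.ofReal (R ^ n) * (ENNReal.ofReal h *
          (φ √(z ^ 2 + h ^ 2) * ψ √((z - ℓ) ^ 2 + h ^ 2))) := by
        refine lintegral_mono fun z => ?_
        rw [lintegral_fun_norm_addHaar volume
          (f := fun h => φ √(z ^ 2 + h ^ 2) * ψ √((z - ℓ) ^ 2 + h ^ 2)) (by fun_prop)]
        refine mul_le_mul_right (setLIntegral_mono' measurableSet_Ioi fun h hh => ?_) _
        have := mul_le_mul_left (hφ0 z h hh) (ψ √((z - ℓ) ^ 2 + h ^ 2))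
        simpa [mul_assoc] using this
    _ = V * ENNReal.ofReal (R ^ n) * ∫⁻ z, ∫⁻ h in Ioi (0 : ℝ), ENNReal.ofReal h *
          (φ √(z ^ 2 + h ^ 2) * ψ √((z - ℓ) ^ 2 + h ^ 2)) := by
        simp_rw [lintegral_const_mul' _ _ ofReal_ne_top]
        rw [lintegral_const_mul' _ _ (measure_ne_top _ _), lintegral_const_mul' _ _ ofReal_ne_top,
          mul_assoc]
    _ ≤ V * ENNReal.ofReal (R ^ n) * (4 * ENNReal.ofReal R ^ 2 * (ENNReal.ofReal ℓ)⁻¹ *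
          (∫⁻ r, φ r) * ∫⁻ r, ψ r) :=
        mul_le_mul_right (lintegral_half_plane_le hℓ hφm hψm hφ hψ) _
    _ = _ := by
        rw [hed]
        ring

end Bipolar

section DualEstimate

theorem exists_lintegral_lintegral_rpow_le {d : ℕ} (hd : 2 < d)
    (μ : Measure (EuclideanSpace ℝ (Fin d))) [IsFiniteMeasure μ] [NullSingletonClass μ] {β m P : ℝ}
    (hβ0 : 0 < β) (hβ1 : β < 1) (hm0 : 0 < m) (hm2 : m ≤ 2) (hP : P = 2 / m + 1 / β)
    {L : ℝ≥0∞} (hL : L ≠ ∞) (hμ : ∀ x, ∫⁻ y, edist x y ^ (-β) ∂μ ≤ L) (R : ℝ) :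
    ∃ K : ℝ≥0∞, K ≠ ∞ ∧ ∀ (g : EuclideanSpace ℝ (Fin d) → ℝ → ℝ≥0∞)
      (N : EuclideanSpace ℝ (Fin d) → ℝ≥0∞), Measurable (Function.uncurry g) → Measurable N →
      (∀ x r, r ∉ Ioc 0 R → g x r = 0) → (∀ x, N x ≠ ∞) → (∀ x, N x = 0 → ∀ r, g x r = 0) →
      (∀ x, ∫⁻ r, g x r ^ (P / 2) ≤ N x) →
      ∫⁻ y, (∫⁻ x, g x ‖x - y‖ ∂μ) ^ P ≤ K * (∫⁻ x, N x ^ m ∂μ) ^ (2 / m) := by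
  obtain ⟨K, hK, hbip⟩ := exists_lintegral_bipolar_le hd R
  have hβi : 1 < 1 / β := by rwa [lt_div_iff₀ hβ0, one_mul]
  have hmi : 1 ≤ 2 / m := by rwa [le_div_iff₀ hm0, one_mul]
  have hP0 : 0 < P := by rw [hP]; positivity
  refine ⟨K * L * L ^ (1 / β - 1), ?_, ?_⟩
  · exact ENNReal.mul_ne_top (ENNReal.mul_ne_top hK hL)
      (ENNReal.rpow_ne_top_of_nonneg (by linarith) hL)
  intro g N hg hN hgR hNtop hN0 hgN
  have hgm : ∀ {δ : Type} [MeasurableSpace δ] {v : δ → EuclideanSpace ℝ (Fin d)} {w : δ → ℝ},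
      Measurable v → Measurable w → Measurable fun a => g (v a) (w a) :=
    fun hv hw => hg.comp (hv.prodMk hw)
  set A := ∫⁻ x, N x ^ m ∂μ with hA
  let c : EuclideanSpace ℝ (Fin d) × EuclideanSpace ℝ (Fin d) → ℝ≥0∞ := fun z =>
    edist z.1 z.2 ^ (1 - β) * (N z.1 * N z.2) ^ (m / 2 - 1)
  have hc : Measurable c := by fun_prop
  have hbound : ∀ᵐ z ∂μ.prod μ,
      ∫⁻ y, c z * (g z.1 ‖z.1 - y‖ * g z.2 ‖z.2 - y‖) ^ (P / 2) ≤
        K * ((N z.1 ^ m * N z.2 ^ m) ^ (1 / 2 : ℝ) * edist z.1 z.2 ^ (-β)) := by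
    filter_upwards [ae_prod_edist_ne_zero (μ := μ)] with z hz
    have hm : ∀ x, Measurable fun r => g x r ^ (P / 2) := fun x =>
      (hgm measurable_const measurable_id).pow_const _
    have h := hbip (fun r => g z.1 r ^ (P / 2)) (fun r => g z.2 r ^ (P / 2)) (hm _) (hm _)
      (fun r hr => by rw [hgR _ _ hr, ENNReal.zero_rpow_of_pos (by positivity)])
      (fun r hr => by rw [hgR _ _ hr, ENNReal.zero_rpow_of_pos (by positivity)]) z.1 z.2
      (by simpa using hz)
    simp_rw [← ENNReal.mul_rpow_of_nonneg _ _ (by positivity : (0 : ℝ) ≤ P / 2)] at h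
    have hmm : Measurable fun y => (g z.1 ‖z.1 - y‖ * g z.2 ‖z.2 - y‖) ^ (P / 2) :=
      ((hgm measurable_const (by fun_prop)).mul (hgm measurable_const (by fun_prop))).pow_const _
    rw [lintegral_const_mul _ hmm]
    have he : edist z.1 z.2 ^ (1 - β) * (edist z.1 z.2)⁻¹ = edist z.1 z.2 ^ (-β) := by
      rw [← ENNReal.rpow_neg_one, ← ENNReal.rpow_add _ _ hz (edist_ne_top _ _)]
      congr 1
      ring
    have hW : (N z.1 * N z.2) ^ (m / 2 - 1) * (N z.1 * N z.2) ≤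
        (N z.1 ^ m * N z.2 ^ m) ^ (1 / 2 : ℝ) := by
      rw [← ENNReal.mul_rpow_of_nonneg _ _ hm0.le, ← ENNReal.rpow_mul]
      rcases eq_or_ne (N z.1 * N z.2) 0 with h0 | h0
      · rw [h0, mul_zero]
        exact zero_le
      · nth_rw 2 [← ENNReal.rpow_one (N z.1 * N z.2)]
        rw [← ENNReal.rpow_add _ _ h0 (ENNReal.mul_ne_top (hNtop _) (hNtop _))]
        refine le_of_eq ?_
        congr 1
        ring
    calc c z * ∫⁻ y, (g z.1 ‖z.1 - y‖ * g z.2 ‖z.2 - y‖) ^ (P / 2)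
        ≤ c z * (K * (edist z.1 z.2)⁻¹ * N z.1 * N z.2) := by
          refine mul_le_mul_right (h.trans ?_) _
          gcongr
          · exact hgN _
          · exact hgN _
      _ = K * ((N z.1 * N z.2) ^ (m / 2 - 1) * (N z.1 * N z.2) *
            (edist z.1 z.2 ^ (1 - β) * (edist z.1 z.2)⁻¹)) := by
          simp only [c]
          ring
      _ ≤ _ := by
          rw [he]
          gcongr
  calc ∫⁻ y, (∫⁻ x, g x ‖x - y‖ ∂μ) ^ P
      ≤ ∫⁻ y, (∫⁻ z, c z * (g z.1 ‖z.1 - y‖ * g z.2 ‖z.2 - y‖) ^ (P / 2) ∂μ.prod μ) *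
          (L ^ (1 / β - 1) * A ^ (2 / m - 1)) := by
        refine lintegral_mono fun y => ?_
        rw [← mul_assoc]
        exact lintegral_rpow_le hβ0 hβ1 hm0 hm2 hP hμ hN (hgm (by fun_prop) (by fun_prop)) hNtop
          fun x hx => hN0 x hx _
    _ = (∫⁻ z, (∫⁻ y, c z * (g z.1 ‖z.1 - y‖ * g z.2 ‖z.2 - y‖) ^ (P / 2)) ∂μ.prod μ) *
          (L ^ (1 / β - 1) * A ^ (2 / m - 1)) := by
        have hmeas : Measurable fun a : EuclideanSpace ℝ (Fin d) ×
            (EuclideanSpace ℝ (Fin d) × EuclideanSpace ℝ (Fin d)) =>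
            c a.2 * (g a.2.1 ‖a.2.1 - a.1‖ * g a.2.2 ‖a.2.2 - a.1‖) ^ (P / 2) :=
          (hc.comp measurable_snd).mul
            (((hgm (by fun_prop) (by fun_prop)).mul (hgm (by fun_prop) (by fun_prop))).pow_const _)
        rw [lintegral_mul_const _ hmeas.lintegral_prod_right', lintegral_lintegral_swap]
        exact hmeas.aemeasurable
    _ ≤ (K * (L * A)) * (L ^ (1 / β - 1) * A ^ (2 / m - 1)) := by
        refine mul_le_mul_left ((lintegral_mono_ae hbound).trans ?_) _
        rw [lintegral_const_mul _ (by fun_prop)]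
        exact mul_le_mul_right (lintegral_prod_edist_mul_rpow_half_le hμ (by fun_prop)) _
    _ = K * L * L ^ (1 / β - 1) * (A * A ^ (2 / m - 1)) := by ring
    _ = _ := by
        congr 1
        nth_rw 1 [← ENNReal.rpow_one A]
        rw [← ENNReal.rpow_add_of_nonneg _ _ zero_le_one (by linarith), add_sub_cancel]

end DualEstimate

section MixedNorm

theorem exists_lintegral_lintegral_mul_sphere_le {d : ℕ} (hd : 0 < d)
    (μ : Measure (EuclideanSpace ℝ (Fin d))) [SFinite μ] {p P : ℝ} (hpP : p.HolderConjugate P)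
    {r₀ : ℝ} (hr₀ : 0 < r₀) (R₀ : ℝ) :
    ∃ C : ℝ≥0∞, C ≠ ∞ ∧ ∀ (f : EuclideanSpace ℝ (Fin d) → ℝ≥0∞)
      (g : EuclideanSpace ℝ (Fin d) → ℝ → ℝ≥0∞), Measurable f → Measurable (Function.uncurry g) →
      ∫⁻ x, (∫⁻ r in Ioc r₀ R₀,
        g x r * ∫⁻ σ in sphere 0 1, f (x - r • σ) ∂μH[(d : ℝ) - 1]) ∂μ ≤
        C * ((∫⁻ y, f y ^ p) ^ (1 / p) * (∫⁻ y, (∫⁻ x, g x ‖x - y‖ ∂μ) ^ P) ^ (1 / P)) := by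
  obtain ⟨C, hC, hpolar⟩ := exists_lintegral_mul_sphere_le hd hr₀ R₀
  refine ⟨C, hC, fun f g hf hg => ?_⟩
  have hmeas : Measurable fun z : EuclideanSpace ℝ (Fin d) × EuclideanSpace ℝ (Fin d) =>
      g z.1 ‖z.1 - z.2‖ :=
    hg.comp (measurable_fst.prodMk (by fun_prop))
  calc _ ≤ ∫⁻ x, (C * ∫⁻ y, f y * g x ‖x - y‖) ∂μ :=
        lintegral_mono fun x => hpolar f (g x) hf (hg.comp measurable_prodMk_left) x
    _ = C * ∫⁻ y, f y * ∫⁻ x, g x ‖x - y‖ ∂μ := by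
        rw [lintegral_const_mul' _ _ hC, lintegral_lintegral_swap
          ((hf.comp measurable_snd).mul hmeas).aemeasurable]
        congr 1
        refine lintegral_congr fun y => ?_
        exact lintegral_const_mul _ (hmeas.comp measurable_prodMk_right)
    _ ≤ _ := by
        refine mul_le_mul_right ?_ C
        exact ENNReal.lintegral_mul_le_Lp_mul_Lq volume hpP hf.aemeasurable
          (hmeas.lintegral_prod_left').aemeasurable

theorem exists_mixed_norm_sphere_le {d : ℕ} (hd : 2 < d)
    (μ : Measure (EuclideanSpace ℝ (Fin d))) [IsFiniteMeasure μ] [NullSingletonClass μ]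
    {β m p P q s : ℝ} (hβ0 : 0 < β) (hβ1 : β < 1) (hq : 1 < q) (hs : 1 < s)
    (hpP : p.HolderConjugate P) (hPs : P = 2 * s / (s - 1))
    (hm : m = q / (q - 1) * ((s - 1) / s)) (hm2 : m ≤ 2) (hP : P = 2 / m + 1 / β)
    {L : ℝ≥0∞} (hL : L ≠ ∞) (hμ : ∀ x, ∫⁻ y, edist x y ^ (-β) ∂μ ≤ L)
    {r₀ : ℝ} (hr₀ : 0 < r₀) (R₀ : ℝ) :
    ∃ K : ℝ≥0∞, K ≠ ∞ ∧ ∀ f : EuclideanSpace ℝ (Fin d) → ℝ≥0∞, Measurable f →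
      (∃ B : ℝ≥0∞, B ≠ ∞ ∧ ∀ x, f x ≤ B) →
      (∫⁻ x, (∫⁻ r in Ioc r₀ R₀,
        (∫⁻ σ in sphere 0 1, f (x - r • σ) ∂μH[(d : ℝ) - 1]) ^ s) ^ (q / s) ∂μ) ^ (1 / q) ≤
        K * (∫⁻ y, f y ^ p) ^ (1 / p) := by
  have hs1 : 0 < s - 1 := by linarith
  have hq1 : 0 < q - 1 := by linarith
  have hs0 : 0 < s := by linarith
  have hq0 : 0 < q := by linarith
  have hm0 : 0 < m := by rw [hm]; positivity
  have hP0 : 0 < P := by rw [hPs]; positivity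
  obtain ⟨C, hC, hpair⟩ :=
    exists_lintegral_lintegral_mul_sphere_le (by omega : 0 < d) μ hpP hr₀ R₀
  obtain ⟨K, hK, hdual⟩ :=
    exists_lintegral_lintegral_rpow_le hd μ hβ0 hβ1 hm0 hm2 hP hL hμ R₀
  have hfin := isFiniteMeasure_hausdorffMeasure_restrict_sphere (by omega : 0 < d)
  refine ⟨C * K ^ (1 / P), ENNReal.mul_ne_top hC (ENNReal.rpow_ne_top_of_nonneg (by positivity) hK),
    fun f hf ⟨B, hB, hfB⟩ => ?_⟩
  set F : EuclideanSpace ℝ (Fin d) → ℝ → ℝ≥0∞ := fun x r =>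
    ∫⁻ σ in sphere 0 1, f (x - r • σ) ∂μH[(d : ℝ) - 1] with hFdef
  have hF : Measurable (Function.uncurry F) := by
    refine Measurable.lintegral_prod_right' (f := fun z : (EuclideanSpace ℝ (Fin d) × ℝ) ×
      EuclideanSpace ℝ (Fin d) => f (z.1.1 - z.1.2 • z.2)) ?_
    fun_prop
  have hFs : ∀ x, Measurable fun r => F x r ^ s := fun x =>
    (hF.comp measurable_prodMk_left).pow_const s
  set N₀ : EuclideanSpace ℝ (Fin d) → ℝ≥0∞ := fun x => ∫⁻ r in Ioc r₀ R₀, F x r ^ s with hN₀def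
  have hN₀ : Measurable N₀ := (hF.pow_const s).lintegral_prod_right'
  obtain ⟨B', hB', hN₀B⟩ : ∃ B' : ℝ≥0∞, B' ≠ ∞ ∧ ∀ x, N₀ x ≤ B' := by
    refine ⟨(B * (μH[(d : ℝ) - 1]).restrict (sphere (0 : EuclideanSpace ℝ (Fin d)) 1) univ) ^ s *
      volume.restrict (Ioc r₀ R₀) univ, ?_, fun x => ?_⟩
    · refine ENNReal.mul_ne_top (ENNReal.rpow_ne_top_of_nonneg hs0.le
        (ENNReal.mul_ne_top hB (measure_ne_top _ _))) (measure_ne_top _ _)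
    · rw [← lintegral_const]
      refine lintegral_mono fun r => ?_
      rw [← lintegral_const]
      exact ENNReal.rpow_le_rpow (lintegral_mono fun σ => hfB _) hs0.le
  have hN₀top : ∀ x, N₀ x ≠ ∞ := fun x => ((hN₀B x).trans_lt hB'.lt_top).ne
  let G : EuclideanSpace ℝ (Fin d) → ℝ≥0∞ := fun x =>
    if N₀ x = 0 then 0 else N₀ x ^ ((q - s) / s)
  have hG : Measurable G :=
    Measurable.ite (hN₀ (measurableSet_singleton 0)) measurable_const (hN₀.pow_const _)
  let g : EuclideanSpace ℝ (Fin d) → ℝ → ℝ≥0∞ := fun x r =>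
    (Ioc r₀ R₀).indicator (fun r => F x r ^ (s - 1)) r * G x
  have hg : Measurable (Function.uncurry g) := by
    refine Measurable.mul ?_ (hG.comp measurable_fst)
    exact (hF.pow_const (s - 1)).indicator (measurable_snd measurableSet_Ioc)
  have hNm : ∀ x, (N₀ x ^ ((q - 1) / (s - 1))) ^ m = N₀ x ^ (q / s) := by
    intro x
    rw [← ENNReal.rpow_mul]
    congr 1
    rw [hm]
    field_simp
  have hdual' := hdual g (fun x => N₀ x ^ ((q - 1) / (s - 1))) hg (hN₀.pow_const _) ?_ ?_ ?_ ?_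
  rotate_left
  · intro x r hr
    have : r ∉ Ioc r₀ R₀ := fun h => hr ⟨hr₀.trans h.1, h.2⟩
    simp [g, this]
  · exact fun x => ENNReal.rpow_ne_top_of_nonneg (by positivity) (hN₀top x)
  · intro x hx r
    have : N₀ x = 0 := by
      rwa [ENNReal.rpow_eq_zero_iff_of_pos (by positivity)] at hx
    simp [g, G, this]
  · intro x
    have h1 : ∀ r, g x r ^ (P / 2) =
        (Ioc r₀ R₀).indicator (fun r => F x r ^ s) r * G x ^ (P / 2) := by
      intro r
      simp only [g]
      rw [ENNReal.mul_rpow_of_nonneg _ _ (by positivity)]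
      by_cases hr : r ∈ Ioc r₀ R₀
      · rw [indicator_of_mem hr, indicator_of_mem hr, ← ENNReal.rpow_mul]
        congr 2
        rw [hPs]
        field_simp
      · rw [indicator_of_notMem hr, indicator_of_notMem hr,
          ENNReal.zero_rpow_of_pos (by positivity)]
    simp_rw [h1]
    rw [lintegral_mul_const _ ((hFs x).indicator measurableSet_Ioc), lintegral_indicator measurableSet_Ioc]
    change N₀ x * G x ^ (P / 2) ≤ _
    rcases eq_or_ne (N₀ x) 0 with h0 | h0
    · simp [h0]
    · simp only [G, if_neg h0]
      rw [← ENNReal.rpow_mul]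
      nth_rw 1 [← ENNReal.rpow_one (N₀ x)]
      rw [← ENNReal.rpow_add _ _ h0 (hN₀top x)]
      refine le_of_eq ?_
      congr 1
      rw [hPs]
      field_simp
      ring
  simp_rw [hNm] at hdual'
  set I := ∫⁻ x, N₀ x ^ (q / s) ∂μ with hI
  have hItop : I ≠ ∞ := by
    refine ((lintegral_mono fun x =>
      ENNReal.rpow_le_rpow (hN₀B x) (by positivity : 0 ≤ q / s)).trans_lt ?_).ne
    rw [lintegral_const]
    exact ENNReal.mul_lt_top (ENNReal.rpow_lt_top_of_nonneg (by positivity) hB')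
      (measure_lt_top _ _)
  have hgF : ∀ x, N₀ x ^ (q / s) = ∫⁻ r in Ioc r₀ R₀, g x r * F x r := by
    intro x
    have h1 : ∀ r ∈ Ioc r₀ R₀, g x r * F x r = F x r ^ s * G x := by
      intro r hr
      simp only [g, indicator_of_mem hr]
      rw [mul_right_comm]
      congr 1
      nth_rw 2 [← ENNReal.rpow_one (F x r)]
      rw [← ENNReal.rpow_add_of_nonneg _ _ hs1.le zero_le_one, sub_add_cancel]
    rw [setLIntegral_congr_fun measurableSet_Ioc h1,
      lintegral_mul_const _ (hFs x)]
    change _ = N₀ x * G x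
    rcases eq_or_ne (N₀ x) 0 with h0 | h0
    · simp only [h0, zero_mul]
      exact ENNReal.zero_rpow_of_pos (by positivity)
    · simp only [G, if_neg h0]
      nth_rw 2 [← ENNReal.rpow_one (N₀ x)]
      rw [← ENNReal.rpow_add _ _ h0 (hN₀top x)]
      congr 1
      field_simp
      ring
  have hmain : I ≤ C * ((∫⁻ y, f y ^ p) ^ (1 / p) * (K * I ^ (2 / m)) ^ (1 / P)) := by
    calc I = ∫⁻ x, (∫⁻ r in Ioc r₀ R₀, g x r * F x r) ∂μ := lintegral_congr hgF
      _ ≤ _ := hpair f g hf hg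
      _ ≤ _ := by gcongr
  rcases eq_or_ne I 0 with h0 | h0
  · rw [h0, ENNReal.zero_rpow_of_pos (by positivity)]
    exact zero_le
  have hexp : 2 / m * (1 / P) = 1 - 1 / q := by
    rw [hm, hPs]
    field_simp
  have hIpos : I ^ (1 - 1 / q) ≠ 0 := (ENNReal.rpow_pos (pos_iff_ne_zero.2 h0) hItop).ne'
  have hIfin : I ^ (1 - 1 / q) ≠ ∞ := ENNReal.rpow_ne_top_of_nonneg
    (by rw [← hexp]; positivity) hItop
  rw [← ENNReal.mul_le_mul_iff_left hIpos hIfin, ← ENNReal.rpow_add _ _ h0 hItop, add_sub_cancel,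
    ENNReal.rpow_one]
  refine hmain.trans_eq ?_
  rw [ENNReal.mul_rpow_of_nonneg _ _ (by positivity), ← ENNReal.rpow_mul, hexp]
  ring

end MixedNorm

section SphericalAverage

theorem enorm_sphAvg_le {d : ℕ} (f : EuclideanSpace ℝ (Fin d) → ℝ)
    (x : EuclideanSpace ℝ (Fin d)) (r : ℝ) :
    ‖sphAvg f x r‖ₑ ≤ ∫⁻ σ in sphere 0 1, ‖f (x - r • σ)‖ₑ ∂μH[(d : ℝ) - 1] :=
  enorm_integral_le_lintegral_enorm _

theorem enorm_intervalIntegral_sphAvg_rpow_le {d : ℕ} (f : EuclideanSpace ℝ (Fin d) → ℝ)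
    (x : EuclideanSpace ℝ (Fin d)) {r₀ R₀ s : ℝ} (hr : r₀ ≤ R₀) (hs : 0 < s) :
    ‖(∫ r in r₀..R₀, |sphAvg f x r| ^ s) ^ (1 / s)‖ₑ ≤
      (∫⁻ r in Ioc r₀ R₀,
        (∫⁻ σ in sphere 0 1, ‖f (x - r • σ)‖ₑ ∂μH[(d : ℝ) - 1]) ^ s) ^ (1 / s) := by
  have h0 : 0 ≤ ∫ r in r₀..R₀, |sphAvg f x r| ^ s :=
    intervalIntegral.integral_nonneg hr fun r _ => by positivity
  rw [Real.enorm_rpow_of_nonneg h0 (by positivity), intervalIntegral.integral_of_le hr]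
  refine ENNReal.rpow_le_rpow ((enorm_integral_le_lintegral_enorm _).trans ?_) (by positivity)
  refine lintegral_mono fun r => ?_
  rw [Real.enorm_rpow_of_nonneg (abs_nonneg _) hs.le, Real.enorm_abs]
  exact ENNReal.rpow_le_rpow (enorm_sphAvg_le f x r) hs.le

theorem eLpNorm_intervalIntegral_sphAvg_rpow_le {d : ℕ} (f : EuclideanSpace ℝ (Fin d) → ℝ)
    (μ : Measure (EuclideanSpace ℝ (Fin d))) {r₀ R₀ s : ℝ} (hr : r₀ ≤ R₀) (hs : 0 < s)
    {q : ℝ≥0∞} (hq0 : q ≠ 0) (hq : q ≠ ∞) :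
    eLpNorm (fun x => (∫ r in r₀..R₀, |sphAvg f x r| ^ s) ^ (1 / s)) q μ ≤
      (∫⁻ x, (∫⁻ r in Ioc r₀ R₀, (∫⁻ σ in sphere 0 1, ‖f (x - r • σ)‖ₑ
        ∂μH[(d : ℝ) - 1]) ^ s) ^ (q.toReal / s) ∂μ) ^ (1 / q.toReal) := by
  rw [eLpNorm_eq_lintegral_rpow_enorm_toReal hq0 hq]
  refine ENNReal.rpow_le_rpow (lintegral_mono fun x => ?_) (by positivity)
  refine (ENNReal.rpow_le_rpow (enorm_intervalIntegral_sphAvg_rpow_le f x hr hs)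
    toReal_nonneg).trans_eq ?_
  rw [← ENNReal.rpow_mul, one_div_mul_eq_div]

theorem exists_eLpNorm_top_intervalIntegral_sphAvg_le {d : ℕ} (hd : 0 < d)
    (μ : Measure (EuclideanSpace ℝ (Fin d))) {r₀ R₀ : ℝ} (hr₀ : 0 < r₀) (hr : r₀ ≤ R₀) :
    ∃ K : ℝ≥0∞, K ≠ ∞ ∧ ∀ f : EuclideanSpace ℝ (Fin d) → ℝ, Measurable f →
      eLpNorm (fun x => (∫ r in r₀..R₀, |sphAvg f x r| ^ (1 : ℝ)) ^ (1 / 1 : ℝ)) ∞ μ ≤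
        K * eLpNorm f 1 volume := by
  obtain ⟨K, hK, hle⟩ := exists_lintegral_mul_sphere_le hd hr₀ R₀
  refine ⟨K, hK, fun f hf => ?_⟩
  rw [eLpNorm_exponent_top, eLpNorm_one_eq_lintegral_enorm]
  refine eLpNormEssSup_le_of_ae_enorm_bound (Filter.Eventually.of_forall fun x => ?_)
  refine (enorm_intervalIntegral_sphAvg_rpow_le f x hr one_pos).trans ?_
  simpa using hle (fun y => ‖f y‖ₑ) (fun _ => 1) hf.enorm measurable_const x

theorem exists_eLpNorm_intervalIntegral_sphAvg_rpow_le {d : ℕ} (hd : 2 < d)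
    (μ : Measure (EuclideanSpace ℝ (Fin d))) [IsFiniteMeasure μ] [NullSingletonClass μ]
    {β t p s : ℝ} {q : ℝ≥0∞} (hβ0 : 0 < β) (hβ1 : β < 1) (ht0 : 0 < t) (ht1 : t < 1)
    (hp : 1 / p = t * (1 / (1 + β)) + (1 - t) * 1)
    (hq : q⁻¹ = ENNReal.ofReal (t * (1 / (1 + β))))
    (hs : 1 / s = t * ((1 - β) / (1 + β)) + (1 - t) * 1)
    {L : ℝ≥0∞} (hL : L ≠ ∞) (hμ : ∀ x, ∫⁻ y, edist x y ^ (-β) ∂μ ≤ L)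
    {r₀ R₀ : ℝ} (hr₀ : 0 < r₀) (hr : r₀ ≤ R₀) :
    ∃ K : ℝ≥0∞, K ≠ ∞ ∧ ∀ f : EuclideanSpace ℝ (Fin d) → ℝ, Measurable f →
      (∃ M, ∀ x, |f x| ≤ M) →
      eLpNorm (fun x => (∫ r in r₀..R₀, |sphAvg f x r| ^ s) ^ (1 / s)) q μ ≤
        K * eLpNorm f (ENNReal.ofReal p) volume := by
  have h1β : 0 < 1 + β := by linarith
  have htβ : t * β < t := mul_lt_of_lt_one_right ht0 hβ1
  have htβ0 : 0 < t * β := by positivity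
  have hqpos : 0 < t * (1 / (1 + β)) := by positivity
  have hq0 : q ≠ 0 := fun h => by simp [h] at hq
  have hqtop : q ≠ ∞ := fun h => by
    rw [h, ENNReal.inv_top, eq_comm, ENNReal.ofReal_eq_zero] at hq
    linarith
  have hqr : q.toReal = (1 + β) / t := by
    rw [← inv_inj, ← ENNReal.toReal_inv, hq, ENNReal.toReal_ofReal hqpos.le]
    field_simp
  have hpr : p = (1 + β) / (1 + β - t * β) := by
    rw [← inv_inj, ← one_div, hp]
    field_simp
    ring
  have hsr : s = (1 + β) / (1 + β - 2 * t * β) := by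
    rw [← inv_inj, ← one_div, hs]
    field_simp
    ring
  have hden1 : 0 < 1 + β - t * β := by linarith
  have hden2 : 0 < 1 + β - 2 * t * β := by nlinarith
  have hden3 : 0 < 1 + β - t := by linarith
  have hp0 : 0 < p := by rw [hpr]; positivity
  have hs1 : 1 < s := by
    rw [hsr, one_lt_div hden2]
    linarith
  have hq1 : 1 < q.toReal := by
    rw [hqr, one_lt_div ht0]
    linarith
  have hsub : s - 1 = 2 * t * β / (1 + β - 2 * t * β) := by
    rw [hsr, div_sub_one hden2.ne', _root_.sub_sub_cancel]
  have hqsub : q.toReal - 1 = (1 + β - t) / t := by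
    rw [hqr]
    field_simp
  have hPs : (1 + β) / (t * β) = 2 * s / (s - 1) := by
    rw [hsub, hsr]
    generalize 1 + β - 2 * t * β = c at hden2
    field_simp
  have hm : 2 * t * β / (1 + β - t) = q.toReal / (q.toReal - 1) * ((s - 1) / s) := by
    rw [hqsub, hsub, hsr, hqr]
    generalize 1 + β - 2 * t * β = c at hden2
    field_simp
  have hm2 : 2 * t * β / (1 + β - t) ≤ 2 := by
    rw [div_le_iff₀ hden3]
    nlinarith
  have hP : (1 + β) / (t * β) = 2 / (2 * t * β / (1 + β - t)) + 1 / β := by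
    field_simp
    ring
  have hpP : p.HolderConjugate ((1 + β) / (t * β)) := by
    rw [Real.holderConjugate_iff]
    constructor
    · rw [hpr, one_lt_div hden1]
      linarith
    · rw [hpr]
      field_simp
      ring
  obtain ⟨K, hK, hle⟩ := exists_mixed_norm_sphere_le hd μ hβ0 hβ1 hq1 hs1 hpP hPs hm hm2 hP hL hμ
    hr₀ R₀
  refine ⟨K, hK, fun f hf ⟨M, hM⟩ => ?_⟩
  refine (eLpNorm_intervalIntegral_sphAvg_rpow_le f μ hr (by linarith) hq0 hqtop).trans ?_
  refine (hle (fun y => ‖f y‖ₑ) hf.enorm ⟨ENNReal.ofReal M, ofReal_ne_top, fun x => ?_⟩).trans_eq ?_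
  · rw [← ofReal_norm]
    exact ENNReal.ofReal_le_ofReal (hM x)
  · rw [eLpNorm_eq_lintegral_rpow_enorm_toReal (by simpa using hp0) ofReal_ne_top,
      ENNReal.toReal_ofReal hp0.le]

end SphericalAverage

end

/-- Theorem 3(c): mixed-norm estimate for the spherical averaging operator relative to
a measure `λ` on `ℝ^d`, `d > 2`, with `λ(B(x,δ)) ≤ C δ^{α'}`, `0 < α < α' < 1`, at the
exponents `(1/p, 1/q, 1/s) = t(1/(1+α), 1/(1+α), (1-α)/(1+α)) + (1-t)(1, 0, 1)`,
`0 ≤ t < 1`. -/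
theorem stmt_7 (d : ℕ) (hd : 2 < d) (lam : Measure (EuclideanSpace ℝ (Fin d)))
    [IsProbabilityMeasure lam]
    (hcomp : ∃ K : Set (EuclideanSpace ℝ (Fin d)), IsCompact K ∧ lam Kᶜ = 0)
    (α α' C : ℝ) (hα0 : 0 < α) (hαα' : α < α') (hα' : α' < 1)
    (hfrost : ∀ (x : EuclideanSpace ℝ (Fin d)) (δ : ℝ), 0 < δ →
      lam (Metric.ball x δ) ≤ ENNReal.ofReal (C * δ ^ α'))
    (r0 R0 : ℝ) (hr0 : 0 < r0) (hR0 : r0 < R0) (t : ℝ) (ht0 : 0 ≤ t) (ht1 : t < 1)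
    (p s : ℝ) (q : ℝ≥0∞)
    (hp : 1 / p = t * (1 / (1 + α)) + (1 - t) * 1)
    (hq : q⁻¹ = ENNReal.ofReal (t * (1 / (1 + α))))
    (hs : 1 / s = t * ((1 - α) / (1 + α)) + (1 - t) * 1) :
    ∃ C' > 0, ∀ f : EuclideanSpace ℝ (Fin d) → ℝ, Measurable f →
      (∃ M, ∀ x, |f x| ≤ M) → HasCompactSupport f →
      eLpNorm (fun x => (∫ r in r0..R0, |sphAvg f x r| ^ s) ^ (1 / s)) q lam
        ≤ ENNReal.ofReal C' * eLpNorm f (ENNReal.ofReal p) volume := by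
  have hK : ∃ K : ℝ≥0∞, K ≠ ∞ ∧ ∀ f : EuclideanSpace ℝ (Fin d) → ℝ, Measurable f →
      (∃ M, ∀ x, |f x| ≤ M) →
      eLpNorm (fun x => (∫ r in r0..R0, |sphAvg f x r| ^ s) ^ (1 / s)) q lam ≤
        K * eLpNorm f (ENNReal.ofReal p) volume := by
    rcases ht0.eq_or_lt with rfl | ht0
    · obtain rfl : p = 1 := by simpa using hp
      obtain rfl : s = 1 := by simpa using hs
      obtain rfl : q = ∞ := by simpa using hq
      obtain ⟨K, hK, hle⟩ := exists_eLpNorm_top_intervalIntegral_sphAvg_le (by omega : 0 < d) lam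
        hr0 hR0.le
      exact ⟨K, hK, fun f hf _ => by simpa using hle f hf⟩
    · obtain ⟨L, hL, hle⟩ := exists_lintegral_edist_rpow_neg_le lam hα0 hαα' hfrost
      have : NullSingletonClass lam := ⟨fun x =>
        measure_singleton_eq_zero_of_lintegral_edist_rpow_neg_ne_top hα0
          ((hle x).trans_lt hL.lt_top).ne⟩
      exact exists_eLpNorm_intervalIntegral_sphAvg_rpow_le hd lam hα0 (hαα'.trans hα') ht0 ht1
        hp hq hs hL hle hr0 hR0.le
  obtain ⟨K, hK, hle⟩ := hK
  refine ⟨K.toReal + 1, by positivity, fun f hf hb _ => (hle f hf hb).trans ?_⟩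
  gcongr
  exact (ENNReal.le_ofReal_iff_toReal_le hK (by positivity)).2 (by linarith)
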